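/- Let ψ be a flow on a metric space (X,d). If every continuous Lyapunov function for ψ is constant, then ψ is strongly chain recurrent. -/

import Mathlib

/-- A (continuous) flow on a metric space. -/
def IsFlow {X : Type*} [MetricSpace X] (ψ : ℝ → X → X) : Prop :=
  Continuous (fun p : ℝ × X => ψ p.1 p.2) ∧ (∀ x, ψ 0 x = x) ∧
    ∀ t s x, ψ (t + s) x = ψ t (ψ s x)

/-- There is a strong `(ε,T)`-chain from `a` to `b`: a finite sequence
`(x_i, t_i)`, `i = 1, …, n` with `t_i ≥ T`, `x_1 = a`, `x_{n+1} = b`, and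
`∑ d(ψ_{t_i}(x_i), x_{i+1}) < ε`. -/
def HasStrongChain {X : Type*} [MetricSpace X] (ψ : ℝ → X → X) (ε T : ℝ) (a b : X) : Prop :=
  ∃ (n : ℕ) (x : Fin (n + 1) → X) (t : Fin n → ℝ), 0 < n ∧ (∀ i, T ≤ t i) ∧
    x 0 = a ∧ x (Fin.last n) = b ∧
    (∑ i : Fin n, dist (ψ (t i) (x i.castSucc)) (x i.succ)) < ε

/-- A strongly chain recurrent point. -/
def StronglyChainRecurrentPt {X : Type*} [MetricSpace X] (ψ : ℝ → X → X) (x : X) : Prop :=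
  ∀ ε > 0, ∀ T ≥ (0 : ℝ), HasStrongChain ψ ε T x x

/-- A Lyapunov function for the flow `ψ`. -/
def IsLyapunov {X : Type*} [MetricSpace X] (ψ : ℝ → X → X) (h : X → ℝ) : Prop :=
  ∀ t ≥ (0 : ℝ), ∀ x, h (ψ t x) ≤ h x

/-- The neutral set of a Lyapunov function. -/
def NeutralSet {X : Type*} [MetricSpace X] (ψ : ℝ → X → X) (h : X → ℝ) : Set X :=
  {x | ∀ t : ℝ, h (ψ t x) = h x}

/-- A first integral for the flow `ψ`. -/
def IsFirstIntegral {X : Type*} [MetricSpace X] (ψ : ℝ → X → X) (h : X → ℝ) : Prop :=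
  ∀ (t : ℝ) (x : X), h (ψ t x) = h x

/-- `ψ_t` is Lipschitz for every `t ≥ 0`, uniformly for `t` in compact subsets
of `[0, +∞)`. -/
def UniformlyLipschitzTimeMaps {X : Type*} [MetricSpace X] (ψ : ℝ → X → X) : Prop :=
  ∀ T ≥ (0 : ℝ), ∃ C : NNReal, ∀ t ∈ Set.Icc 0 T, LipschitzWith C (ψ t)

/-- The flow `ψ` is strongly chain transitive. -/
def StronglyChainTransitive {X : Type*} [MetricSpace X] (ψ : ℝ → X → X) : Prop :=
  ∀ x y : X, ∀ ε > 0, ∀ T ≥ (0 : ℝ), HasStrongChain ψ ε T x y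

open Set

section StrongChains

variable {X : Type*} [MetricSpace X] {ψ : ℝ → X → X} {ε δ T s : ℝ} {a b : X}

lemma HasStrongChain.pos (h : HasStrongChain ψ ε T a b) : 0 < ε := by
  obtain ⟨n, x, t, -, -, -, -, hsum⟩ := h
  exact (Finset.sum_nonneg fun _ _ => dist_nonneg).trans_lt hsum

lemma HasStrongChain.mono (h : HasStrongChain ψ ε T a b) (hεδ : ε ≤ δ) :
    HasStrongChain ψ δ T a b := by
  obtain ⟨n, x, t, hn, ht, ha, hb, hsum⟩ := h
  exact ⟨n, x, t, hn, ht, ha, hb, hsum.trans_le hεδ⟩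

lemma hasStrongChain_flow (hε : 0 < ε) (hs : T ≤ s) : HasStrongChain ψ ε T a (ψ s a) :=
  ⟨1, ![a, ψ s a], fun _ => s, one_pos, fun _ => hs, rfl, rfl, by simpa using hε⟩

/-- Moving the endpoint of a strong chain costs at most the distance moved. -/
lemma HasStrongChain.move_end (h : HasStrongChain ψ ε T a b) (c : X) :
    HasStrongChain ψ (ε + dist b c) T a c := by
  obtain ⟨n, x, t, hn, ht, ha, hb, hsum⟩ := h
  obtain ⟨m, rfl⟩ : ∃ m, n = m + 1 := ⟨n - 1, by omega⟩
  refine ⟨m + 1, Fin.snoc (Fin.init x) c, t, hn, ht, ?_, Fin.snoc_last _ _, ?_⟩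
  · rw [← ha]
    exact Fin.snoc_castSucc (α := fun _ => X) c (Fin.init x) 0
  · rw [Fin.sum_univ_castSucc] at hsum ⊢
    simp only [Fin.succ_castSucc, Fin.snoc_castSucc, Fin.succ_last, Fin.snoc_last, hb,
      Fin.init] at hsum ⊢
    linarith [dist_triangle (ψ (t (Fin.last m)) (x (Fin.last m).castSucc)) b c]

/-- A strong chain can be prolonged along the flow at no cost. -/
lemma HasStrongChain.flow_end (h : HasStrongChain ψ ε T a b) (hs : T ≤ s) :
    HasStrongChain ψ ε T a (ψ s b) := by
  obtain ⟨n, x, t, hn, ht, ha, hb, hsum⟩ := h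
  refine ⟨n + 1, Fin.snoc x (ψ s b), Fin.snoc t s, n.succ_pos, ?_, ?_, Fin.snoc_last _ _, ?_⟩
  · refine Fin.lastCases ?_ fun i => ?_
    · simpa using hs
    · simpa using ht i
  · rw [← ha]
    exact Fin.snoc_castSucc (α := fun _ => X) (ψ s b) x 0
  · rw [Fin.sum_univ_castSucc]
    simpa only [Fin.succ_castSucc, Fin.snoc_castSucc, Fin.succ_last, Fin.snoc_last, hb,
      dist_self, add_zero] using hsum

/-- The infimum of the costs of the strong chains from `a` to `b` with times at least `T`. -/
noncomputable def chainCost (ψ : ℝ → X → X) (T : ℝ) (a b : X) : ℝ :=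
  sInf {ε | HasStrongChain ψ ε T a b}

lemma bddBelow_chainCost : BddBelow {ε | HasStrongChain ψ ε T a b} :=
  ⟨0, fun _ h => HasStrongChain.pos h |>.le⟩

lemma nonempty_chainCost : {ε | HasStrongChain ψ ε T a b}.Nonempty :=
  ⟨_, (hasStrongChain_flow one_pos le_rfl).move_end b⟩

lemma chainCost_le (h : HasStrongChain ψ ε T a b) : chainCost ψ T a b ≤ ε :=
  csInf_le bddBelow_chainCost h

lemma hasStrongChain_of_chainCost_lt (h : chainCost ψ T a b < ε) :
    HasStrongChain ψ ε T a b := by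
  obtain ⟨δ, hδ, hlt⟩ := exists_lt_of_csInf_lt nonempty_chainCost h
  exact HasStrongChain.mono hδ hlt.le

lemma chainCost_flow_self_nonpos (hs : T ≤ s) : chainCost ψ T a (ψ s a) ≤ 0 :=
  le_of_forall_pos_le_add fun δ hδ => by
    simpa using chainCost_le (hasStrongChain_flow hδ hs)

lemma chainCost_flow_le (hs : T ≤ s) : chainCost ψ T a (ψ s b) ≤ chainCost ψ T a b :=
  le_csInf nonempty_chainCost fun _ h => chainCost_le (HasStrongChain.flow_end h hs)

lemma lipschitzWith_chainCost : LipschitzWith 1 (chainCost ψ T a) :=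
  LipschitzWith.of_le_add fun c b => by
    rw [← sub_le_iff_le_add]
    refine le_csInf nonempty_chainCost fun ε h => ?_
    linarith [chainCost_le (HasStrongChain.move_end h c), dist_comm b c]

/-- The largest chain cost from `a` along the orbit segment of `y` of length `T`. -/
noncomputable def maxChainCost (ψ : ℝ → X → X) (T : ℝ) (a y : X) : ℝ :=
  sSup ((fun s => chainCost ψ T a (ψ s y)) '' Icc 0 T)

lemma continuous_maxChainCost (hψ : IsFlow ψ) : Continuous (maxChainCost ψ T a) :=
  isCompact_Icc.continuous_sSup (f := fun y s => chainCost ψ T a (ψ s y))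
    (lipschitzWith_chainCost.continuous.comp (hψ.1.comp continuous_swap))

lemma chainCost_le_maxChainCost (hψ : IsFlow ψ) (hs : s ∈ Icc 0 T) (y : X) :
    chainCost ψ T a (ψ s y) ≤ maxChainCost ψ T a y := by
  have hc : Continuous fun s => chainCost ψ T a (ψ s y) :=
    lipschitzWith_chainCost.continuous.comp (hψ.1.comp (by fun_prop : Continuous fun s => (s, y)))
  exact le_csSup (isCompact_Icc.bddAbove_image hc.continuousOn) (mem_image_of_mem _ hs)

lemma maxChainCost_le (hT : 0 ≤ T) {y : X} {c : ℝ}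
    (h : ∀ s ∈ Icc 0 T, chainCost ψ T a (ψ s y) ≤ c) : maxChainCost ψ T a y ≤ c :=
  csSup_le ((nonempty_Icc.2 hT).image _) (forall_mem_image.2 h)

lemma chainCost_self_le_maxChainCost (hψ : IsFlow ψ) (hT : 0 ≤ T) (y : X) :
    chainCost ψ T a y ≤ maxChainCost ψ T a y := by
  simpa only [hψ.2.1] using chainCost_le_maxChainCost (a := a) hψ (left_mem_Icc.2 hT) y

lemma isLyapunov_maxChainCost (hψ : IsFlow ψ) (hT : 0 ≤ T) :
    IsLyapunov ψ (maxChainCost ψ T a) := by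
  intro t ht y
  refine maxChainCost_le hT fun s hs => ?_
  rw [← hψ.2.2]
  rcases le_total (s + t) T with h | h
  · exact chainCost_le_maxChainCost hψ ⟨add_nonneg hs.1 ht, h⟩ y
  · exact (chainCost_flow_le h).trans (chainCost_self_le_maxChainCost hψ hT y)

lemma maxChainCost_flow_nonpos (hψ : IsFlow ψ) (hT : 0 ≤ T) :
    maxChainCost ψ T a (ψ T a) ≤ 0 :=
  maxChainCost_le hT fun s hs => by
    rw [← hψ.2.2]
    exact chainCost_flow_self_nonpos (le_add_of_nonneg_left hs.1)

end StrongChains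

theorem SCR_of_continuous_lyapunov_constant {X : Type*} [MetricSpace X]
    (ψ : ℝ → X → X) (hψ : IsFlow ψ)
    (hconst : ∀ h : X → ℝ, Continuous h → IsLyapunov ψ h → ∀ x y : X, h x = h y) :
    ∀ x, StronglyChainRecurrentPt ψ x := by
  intro x ε hε T hT
  refine hasStrongChain_of_chainCost_lt (lt_of_le_of_lt ?_ hε)
  calc chainCost ψ T x x ≤ maxChainCost ψ T x x := chainCost_self_le_maxChainCost hψ hT x
    _ = maxChainCost ψ T x (ψ T x) :=
      hconst _ (continuous_maxChainCost hψ) (isLyapunov_maxChainCost hψ hT) _ _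
    _ ≤ 0 := maxChainCost_flow_nonpos hψ hT
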